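/- arXiv:2508.07696 — 8 statements merged into one kernel-verified Lean document; each statement's English description precedes it below -/
import Mathlib

section
/- Let G ≥ 1 and let D, Δf, σ², P' be positive reals, and for each i ∈ {1,…,G} let B_i > 0 and λ_i > 0. Let y* > 0 be the unique solution of Σ_{i=1}^G (σ²/λ_i²)·(2^{D·B_i/(y*·Δf)} − 1) = P', and set P*_i = (σ²/λ_i²)·(2^{D·B_i/(y*·Δf)} − 1). Then: (i) P*_i > 0 for all i and Σ_i P*_i = P'; (ii) D·B_i/(Δf·log₂(1 + P*_i·λ_i²/σ²)) = y* for every i; and (iii) for every P ∈ ℝ^G with P_i > 0 for all i and Σ_i P_i = P', one has max_i D·B_i/(Δf·log₂(1 + P_i·λ_i²/σ²)) ≥ y*. Hence P* minimizes the worst-case latency max_i L_i(P) over the total-power constraint, and the minimum value is y*. -/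
open Filter Set

theorem stmt_1 (G : ℕ) (hG : 1 ≤ G) (D Δf σ2 P' : ℝ) (hD : 0 < D) (hΔf : 0 < Δf)
    (hσ2 : 0 < σ2) (hP' : 0 < P') (B lam : Fin G → ℝ) (hB : ∀ i, 0 < B i)
    (hlam : ∀ i, 0 < lam i) (ystar : ℝ) (hy : 0 < ystar)
    (heq : ∑ i, (σ2 / (lam i) ^ 2) * ((2 : ℝ) ^ (D * B i / (ystar * Δf)) - 1) = P')
    (Pstar : Fin G → ℝ)
    (hPdef : ∀ i, Pstar i = (σ2 / (lam i) ^ 2) * ((2 : ℝ) ^ (D * B i / (ystar * Δf)) - 1)) :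
    (∀ i, 0 < Pstar i) ∧ (∑ i, Pstar i = P') ∧
    (∀ i, D * B i / (Δf * Real.logb 2 (1 + Pstar i * (lam i) ^ 2 / σ2)) = ystar) ∧
    (∀ P : Fin G → ℝ, (∀ i, 0 < P i) → (∑ i, P i = P') →
      ∃ i, ystar ≤ D * B i / (Δf * Real.logb 2 (1 + P i * (lam i) ^ 2 / σ2))) := by
  have hpos : ∀ i, 0 < Pstar i := fun i ↦ by
    have hexp : 0 < D * B i / (ystar * Δf) :=
      div_pos (mul_pos hD (hB i)) (mul_pos hy hΔf)
    rw [hPdef i]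
    exact mul_pos (div_pos hσ2 (pow_pos (hlam i) 2))
      (sub_pos.2 (Real.one_lt_rpow one_lt_two hexp))
  have hsum : ∑ i, Pstar i = P' := by simpa only [hPdef] using heq
  have hlat : ∀ i, D * B i / (Δf * Real.logb 2 (1 + Pstar i * (lam i) ^ 2 / σ2)) = ystar := by
    intro i
    have hl := (hlam i).ne'
    have hsnr : 1 + Pstar i * (lam i) ^ 2 / σ2 = (2 : ℝ) ^ (D * B i / (ystar * Δf)) := by
      rw [hPdef i]
      field_simp
      ring
    have hb := (hB i).ne'
    rw [hsnr, Real.logb_rpow two_pos (by norm_num)]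
    field_simp
  refine ⟨hpos, hsum, hlat, fun P hP hPsum ↦ ?_⟩
  have : Nonempty (Fin G) := ⟨⟨0, hG⟩⟩
  obtain ⟨i, -, hi⟩ := Finset.exists_le_of_sum_le (s := Finset.univ) Finset.univ_nonempty
    (hPsum.trans hsum.symm).le
  refine ⟨i, (hlat i).symm.le.trans ?_⟩
  have hsnr : 0 < P i * (lam i) ^ 2 / σ2 :=
    div_pos (mul_pos (hP i) (pow_pos (hlam i) 2)) hσ2
  have hlog : 0 < Real.logb 2 (1 + P i * (lam i) ^ 2 / σ2) :=
    Real.logb_pos one_lt_two (by linarith)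
  have hmono : Real.logb 2 (1 + P i * (lam i) ^ 2 / σ2)
      ≤ Real.logb 2 (1 + Pstar i * (lam i) ^ 2 / σ2) :=
    Real.logb_le_logb_of_le one_lt_two (by linarith) (by gcongr)
  exact div_le_div_of_nonneg_left (mul_pos hD (hB i)).le (mul_pos hΔf hlog)
    (mul_le_mul_of_nonneg_left hmono hΔf.le)
end

section
/- Let G ≥ 1 and let D, Δf, σ², P' be positive reals, and for each i ∈ {1,…,G} let B_i > 0 and λ_i > 0. Let y* > 0 be the unique solution of Σ_{i=1}^G (σ²/λ_i²)·(2^{D·B_i/(y*·Δf)} − 1) = P'. If P ∈ ℝ^G satisfies P_i > 0 for all i, Σ_i P_i = P', and max_i D·B_i/(Δf·log₂(1 + P_i·λ_i²/σ²)) = y* (i.e., P is optimal for the min-max latency problem), then D·B_i/(Δf·log₂(1 + P_i·λ_i²/σ²)) = y* for every i, and P_i = (σ²/λ_i²)·(2^{D·B_i/(y*·Δf)} − 1) for every i. In particular, the optimal power allocation equalizes all per-block latencies and is unique. -/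
open Filter Set

/-- A per-block latency is at most `y` exactly when the power is at least the inverse of the
latency function at `y`. -/
theorem latency_le_iff {c F s l p y : ℝ} (hF : 0 < F) (hs : 0 < s) (hl : 0 < l) (hp : 0 < p)
    (hy : 0 < y) :
    c / (F * Real.logb 2 (1 + p * l ^ 2 / s)) ≤ y ↔
      s / l ^ 2 * ((2 : ℝ) ^ (c / (y * F)) - 1) ≤ p := by
  have hx : 0 < p * l ^ 2 / s := by positivity
  have hlog : 0 < Real.logb 2 (1 + p * l ^ 2 / s) :=
    Real.logb_pos one_lt_two (by linarith)
  calc c / (F * Real.logb 2 (1 + p * l ^ 2 / s)) ≤ y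
      ↔ c / (y * F) ≤ Real.logb 2 (1 + p * l ^ 2 / s) := by
        rw [div_le_iff₀ (by positivity), div_le_iff₀ (by positivity)]
        ring_nf
    _ ↔ (2 : ℝ) ^ (c / (y * F)) - 1 ≤ p * l ^ 2 / s := by
        rw [Real.le_logb_iff_rpow_le one_lt_two (by linarith), sub_le_iff_le_add']
    _ ↔ s / l ^ 2 * ((2 : ℝ) ^ (c / (y * F)) - 1) ≤ p := by
        rw [le_div_iff₀ hs, div_mul_eq_mul_div, div_le_iff₀ (by positivity), mul_comm s]

/-- The power inverting the latency function at `y` has latency `y`. -/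
theorem latency_inverse_power {c F s l y : ℝ} (hc : c ≠ 0) (hF : F ≠ 0) (hs : s ≠ 0)
    (hl : l ≠ 0) (hy : y ≠ 0) :
    c / (F * Real.logb 2 (1 + s / l ^ 2 * ((2 : ℝ) ^ (c / (y * F)) - 1) * l ^ 2 / s)) = y := by
  have h : 1 + s / l ^ 2 * ((2 : ℝ) ^ (c / (y * F)) - 1) * l ^ 2 / s =
      (2 : ℝ) ^ (c / (y * F)) := by
    field_simp
    ring
  rw [h, Real.logb_rpow two_pos (by norm_num)]
  field_simp

theorem stmt_2 (G : ℕ) (hG : 1 ≤ G) (D Δf σ2 P' : ℝ) (hD : 0 < D) (hΔf : 0 < Δf)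
    (hσ2 : 0 < σ2) (hP' : 0 < P') (B lam : Fin G → ℝ) (hB : ∀ i, 0 < B i)
    (hlam : ∀ i, 0 < lam i) (ystar : ℝ) (hy : 0 < ystar)
    (heq : ∑ i, (σ2 / (lam i) ^ 2) * ((2 : ℝ) ^ (D * B i / (ystar * Δf)) - 1) = P')
    (P : Fin G → ℝ) (hPpos : ∀ i, 0 < P i) (hPsum : ∑ i, P i = P')
    (hle : ∀ i, D * B i / (Δf * Real.logb 2 (1 + P i * (lam i) ^ 2 / σ2)) ≤ ystar)
    (hattain : ∃ i, D * B i / (Δf * Real.logb 2 (1 + P i * (lam i) ^ 2 / σ2)) = ystar) :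
    ∀ i, D * B i / (Δf * Real.logb 2 (1 + P i * (lam i) ^ 2 / σ2)) = ystar ∧
      P i = (σ2 / (lam i) ^ 2) * ((2 : ℝ) ^ (D * B i / (ystar * Δf)) - 1) := by
  have hmin : ∀ i ∈ Finset.univ,
      (σ2 / (lam i) ^ 2) * ((2 : ℝ) ^ (D * B i / (ystar * Δf)) - 1) ≤ P i := fun i _ =>
    (latency_le_iff hΔf hσ2 (hlam i) (hPpos i) hy).1 (hle i)
  have hP := (Finset.sum_eq_sum_iff_of_le hmin).1 (heq.trans hPsum.symm)
  intro i
  have hPi := (hP i (Finset.mem_univ i)).symm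
  refine ⟨?_, hPi⟩
  rw [hPi]
  exact latency_inverse_power (mul_pos hD (hB i)).ne' hΔf.ne' hσ2.ne' (hlam i).ne' hy.ne'
end

section
/- Let G ≥ 1, let a_i > 0 for i ∈ {1,…,G} be weights, let m ∈ ℝ and M_i ≥ m be box bounds, and let S satisfy G·m ≤ S ≤ Σ_{i=1}^G M_i. For ν > 0 define B_i(ν) = min(M_i, max(m, (1/2)·log₂(2·ln 2·a_i/ν))). Then the map ν ↦ Σ_{i=1}^G B_i(ν) is continuous and nonincreasing on (0,∞), equals Σ_i M_i for all sufficiently small ν > 0 and equals G·m for all sufficiently large ν; consequently there exists ν* > 0 with Σ_{i=1}^G B_i(ν*) = S. -/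
open Filter Set

section LogLevel

variable {c : ℝ}

lemma continuousOn_half_logb_div (hc : 0 < c) :
    ContinuousOn (fun ν : ℝ => (1 / 2) * Real.logb 2 (c / ν)) (Ioi 0) := by
  refine ContinuousOn.mul continuousOn_const (ContinuousOn.logb ?_ ?_)
  · exact continuousOn_const.div continuousOn_id fun ν hν => (mem_Ioi.1 hν).ne'
  · exact fun ν hν => (div_pos hc hν).ne'

lemma antitoneOn_half_logb_div (hc : 0 < c) :
    AntitoneOn (fun ν : ℝ => (1 / 2) * Real.logb 2 (c / ν)) (Ioi 0) := by
  intro x hx y hy hxy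
  have hx' : 0 < x := hx
  have hy' : 0 < y := hy
  have : Real.logb 2 (c / y) ≤ Real.logb 2 (c / x) :=
    Real.logb_le_logb_of_le one_lt_two (div_pos hc hy') (by gcongr)
  simpa using this

lemma tendsto_half_logb_div_nhdsGT_zero (hc : 0 < c) :
    Tendsto (fun ν : ℝ => (1 / 2) * Real.logb 2 (c / ν)) (nhdsWithin 0 (Ioi 0)) atTop := by
  refine Tendsto.const_mul_atTop one_half_pos ((Real.tendsto_logb_atTop one_lt_two).comp ?_)
  exact (tendsto_inv_nhdsGT_zero.const_mul_atTop hc).congr fun ν => (div_eq_mul_inv c ν).symm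

lemma tendsto_half_logb_div_atTop (hc : 0 < c) :
    Tendsto (fun ν : ℝ => (1 / 2) * Real.logb 2 (c / ν)) atTop atBot := by
  have h : Tendsto (fun ν : ℝ => (1 / 2) * Real.logb 2 (ν / c)) atTop atTop :=
    Tendsto.const_mul_atTop one_half_pos
      ((Real.tendsto_logb_atTop one_lt_two).comp (tendsto_id.atTop_div_const hc))
  refine (tendsto_neg_atTop_atBot.comp h).congr fun ν => ?_
  rw [Function.comp_apply, ← inv_div ν c, Real.logb_inv, mul_neg]

end LogLevel

theorem stmt_3 (G : ℕ) (hG : 1 ≤ G) (a : Fin G → ℝ) (ha : ∀ i, 0 < a i)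
    (m : ℝ) (M : Fin G → ℝ) (hM : ∀ i, m ≤ M i) (S : ℝ)
    (hS1 : (G : ℝ) * m ≤ S) (hS2 : S ≤ ∑ i, M i) :
    ContinuousOn
      (fun ν : ℝ => ∑ i, min (M i) (max m ((1 / 2) * Real.logb 2 (2 * Real.log 2 * a i / ν))))
      (Ioi 0) ∧
    AntitoneOn
      (fun ν : ℝ => ∑ i, min (M i) (max m ((1 / 2) * Real.logb 2 (2 * Real.log 2 * a i / ν))))
      (Ioi 0) ∧
    (∃ ν₀ > (0 : ℝ), ∀ ν : ℝ, 0 < ν → ν ≤ ν₀ →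
      ∑ i, min (M i) (max m ((1 / 2) * Real.logb 2 (2 * Real.log 2 * a i / ν))) = ∑ i, M i) ∧
    (∃ ν₁ > (0 : ℝ), ∀ ν : ℝ, ν₁ ≤ ν →
      ∑ i, min (M i) (max m ((1 / 2) * Real.logb 2 (2 * Real.log 2 * a i / ν))) = (G : ℝ) * m) ∧
    ∃ ν : ℝ, 0 < ν ∧
      ∑ i, min (M i) (max m ((1 / 2) * Real.logb 2 (2 * Real.log 2 * a i / ν))) = S := by
  have hc : ∀ i, 0 < 2 * Real.log 2 * a i := fun i =>
    mul_pos (mul_pos two_pos (Real.log_pos one_lt_two)) (ha i)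
  have hcont : ContinuousOn
      (fun ν : ℝ => ∑ i, min (M i) (max m ((1 / 2) * Real.logb 2 (2 * Real.log 2 * a i / ν))))
      (Ioi 0) :=
    continuousOn_finsetSum _ fun i _ =>
      continuousOn_const.inf (continuousOn_const.sup (continuousOn_half_logb_div (hc i)))
  have hsmall : ∃ ν₀ > (0 : ℝ), ∀ ν : ℝ, 0 < ν → ν ≤ ν₀ →
      ∑ i, min (M i) (max m ((1 / 2) * Real.logb 2 (2 * Real.log 2 * a i / ν))) = ∑ i, M i := by
    have h := eventually_all.2 fun i =>
      (tendsto_half_logb_div_nhdsGT_zero (hc i)).eventually_ge_atTop (M i)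
    obtain ⟨ν₀, hν₀, hsub⟩ := mem_nhdsGT_iff_exists_Ioc_subset.1 h
    exact ⟨ν₀, hν₀, fun ν h0 hν => Finset.sum_congr rfl fun i _ =>
      min_eq_left (le_max_of_le_right (hsub ⟨h0, hν⟩ i))⟩
  have hlarge : ∃ ν₁ > (0 : ℝ), ∀ ν : ℝ, ν₁ ≤ ν →
      ∑ i, min (M i) (max m ((1 / 2) * Real.logb 2 (2 * Real.log 2 * a i / ν)))
        = (G : ℝ) * m := by
    have h := eventually_all.2 fun i =>
      (tendsto_half_logb_div_atTop (hc i)).eventually_le_atBot m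
    obtain ⟨ν₁, hν₁⟩ := eventually_atTop.1 h
    refine ⟨max ν₁ 1, by positivity, fun ν hν => ?_⟩
    rw [Finset.sum_congr rfl fun i _ => by
      rw [max_eq_left (hν₁ ν (le_of_max_le_left hν) i), min_eq_right (hM i)]]
    simp
  refine ⟨hcont, ?_, hsmall, hlarge, ?_⟩
  · intro x hx y hy hxy
    exact Finset.sum_le_sum fun i _ =>
      min_le_min_left _ (max_le_max_left _ (antitoneOn_half_logb_div (hc i) hx hy hxy))
  · obtain ⟨ν₀, hν₀, h₀⟩ := hsmall
    obtain ⟨ν₁, hν₁, h₁⟩ := hlarge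
    obtain ⟨ν, hν, h⟩ := isPreconnected_Ioi.intermediate_value (mem_Ioi.2 hν₁) (mem_Ioi.2 hν₀)
      hcont ⟨(h₁ ν₁ le_rfl).trans_le hS1, hS2.trans_eq (h₀ ν₀ hν₀ le_rfl).symm⟩
    exact ⟨ν, hν, h⟩
end

section
/- Let G ≥ 1, let a_i > 0 for i ∈ {1,…,G}, let m ∈ ℝ and M_i ≥ m, and let S ∈ ℝ. Suppose ν* > 0 is such that the allocation B*_i = min(M_i, max(m, (1/2)·log₂(2·ln 2·a_i/ν*))) satisfies Σ_{i=1}^G B*_i = S. Then B* minimizes the objective F(B) = Σ_{i=1}^G a_i·4^{−B_i} over the feasible set {B ∈ ℝ^G : Σ_i B_i = S and m ≤ B_i ≤ M_i for all i}. -/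
open Filter Set

/-- The point where the marginal error `2 log 2 * a * 4 ^ (-t)` equals the multiplier `ν`. -/
lemma mul_four_rpow_neg_half_logb {a ν : ℝ} (ha : 0 < a) (hν : 0 < ν) :
    2 * Real.log 2 * a * (4 : ℝ) ^ (-((1 / 2) * Real.logb 2 (2 * Real.log 2 * a / ν))) = ν := by
  have hL : 0 < Real.log 2 := Real.log_pos one_lt_two
  have hpos : 0 < 2 * Real.log 2 * a / ν := by positivity
  have h4 : (4 : ℝ) = 2 ^ (2 : ℝ) := by norm_num
  rw [h4, ← Real.rpow_mul zero_le_two,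
    show 2 * -((1 / 2) * Real.logb 2 (2 * Real.log 2 * a / ν))
      = -Real.logb 2 (2 * Real.log 2 * a / ν) by ring,
    Real.rpow_neg zero_le_two, Real.rpow_logb zero_lt_two (by norm_num) hpos]
  field_simp

/-- The tangent line inequality for the convex function `x ↦ 4 ^ (-x)`. -/
lemma four_rpow_neg_tangent_le (b x : ℝ) :
    (4 : ℝ) ^ (-b) * (1 - 2 * Real.log 2 * (x - b)) ≤ (4 : ℝ) ^ (-x) := by
  have hlog : Real.log 4 = 2 * Real.log 2 := by
    rw [show (4 : ℝ) = 2 ^ 2 by norm_num, Real.log_pow]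
    norm_num
  have hsplit : (4 : ℝ) ^ (-x) = 4 ^ (-b) * 4 ^ (b - x) := by
    rw [← Real.rpow_add (by norm_num)]
    congr 1
    ring
  rw [hsplit]
  gcongr
  rw [Real.rpow_def_of_pos (by norm_num), hlog]
  linarith [Real.add_one_le_exp (2 * Real.log 2 * (b - x))]

/-- The clamped stationary point minimizes the Lagrangian `a * 4 ^ (-x) + ν * x` on `[m, M]`. -/
lemma lagrangian_clamp_le {a ν m M x : ℝ} (ha : 0 < a) (hν : 0 < ν) (hmx : m ≤ x) (hxM : x ≤ M)
    {b : ℝ} (hb : b = min M (max m ((1 / 2) * Real.logb 2 (2 * Real.log 2 * a / ν)))) :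
    a * (4 : ℝ) ^ (-b) + ν * b ≤ a * (4 : ℝ) ^ (-x) + ν * x := by
  have hL : 0 < Real.log 2 := Real.log_pos one_lt_two
  have ht := mul_four_rpow_neg_half_logb ha hν
  set t := (1 / 2) * Real.logb 2 (2 * Real.log 2 * a / ν)
  have htangent := mul_le_mul_of_nonneg_left (four_rpow_neg_tangent_le b x) ha.le
  have hvar : 0 ≤ (ν - 2 * Real.log 2 * a * (4 : ℝ) ^ (-b)) * (x - b) := by
    rcases lt_trichotomy b t with h | h | h
    · have hbM : b = M := by grind
      refine mul_nonneg_of_nonpos_of_nonpos ?_ (by linarith)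
      rw [sub_nonpos]
      rw [← ht]
      gcongr
      norm_num
    · rw [h, ht, sub_self, zero_mul]
    · have hbm : b = m := by grind
      refine mul_nonneg ?_ (by linarith)
      rw [sub_nonneg]
      rw [← ht]
      gcongr
      norm_num
  linarith

theorem stmt_4 (G : ℕ) (hG : 1 ≤ G) (a : Fin G → ℝ) (ha : ∀ i, 0 < a i)
    (m : ℝ) (M : Fin G → ℝ) (hM : ∀ i, m ≤ M i) (S : ℝ) (ν : ℝ) (hν : 0 < ν)
    (Bstar : Fin G → ℝ)
    (hBdef : ∀ i, Bstar i = min (M i) (max m ((1 / 2) * Real.logb 2 (2 * Real.log 2 * a i / ν))))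
    (hsum : ∑ i, Bstar i = S) :
    ∀ B : Fin G → ℝ, (∑ i, B i = S) → (∀ i, m ≤ B i ∧ B i ≤ M i) →
      ∑ i, a i * (4 : ℝ) ^ (-(Bstar i)) ≤ ∑ i, a i * (4 : ℝ) ^ (-(B i)) := by
  intro B hB hbox
  have hle := Finset.sum_le_sum fun i (_ : i ∈ Finset.univ) =>
    lagrangian_clamp_le (ha i) hν (hbox i).1 (hbox i).2 (hBdef i)
  simp only [Finset.sum_add_distrib, ← Finset.mul_sum, hsum, hB] at hle
  linarith
end

section
/- Let G ≥ 1 and for i ∈ {1,…,G} let a_i > 0, c_i > 0, and b_i ∈ ℝ, and let P' ∈ ℝ satisfy P' + Σ_{i=1}^G b_i/a_i > 0. Set y* = (Σ_{i=1}^G c_i/a_i)/(P' + Σ_{i=1}^G b_i/a_i) and P*_i = (c_i/y* − b_i)/a_i. Then: (i) y* > 0, Σ_i P*_i = P', and a_i·P*_i + b_i = c_i/y* > 0 with c_i/(a_i·P*_i + b_i) = y* for every i; and (ii) for every P ∈ ℝ^G with a_i·P_i + b_i > 0 for all i and Σ_i P_i = P', one has max_i c_i/(a_i·P_i + b_i)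 ≥ y*. Hence P* minimizes max_i c_i/(a_i·P_i + b_i) subject to the total-sum constraint, and the minimum value is y*. -/
theorem stmt_10 (G : ℕ) (hG : 1 ≤ G) (a b c : Fin G → ℝ)
    (ha : ∀ i, 0 < a i) (hc : ∀ i, 0 < c i) (P' : ℝ)
    (hP' : 0 < P' + ∑ i, b i / a i)
    (ystar : ℝ) (hydef : ystar = (∑ i, c i / a i) / (P' + ∑ i, b i / a i))
    (Pstar : Fin G → ℝ) (hPdef : ∀ i, Pstar i = (c i / ystar - b i) / a i) :
    0 < ystar ∧ (∑ i, Pstar i = P') ∧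
    (∀ i, a i * Pstar i + b i = c i / ystar ∧ 0 < c i / ystar ∧
      c i / (a i * Pstar i + b i) = ystar) ∧
    (∀ P : Fin G → ℝ, (∀ i, 0 < a i * P i + b i) → (∑ i, P i = P') →
      ∃ i, ystar ≤ c i / (a i * P i + b i)) := by
  have : NeZero G := ⟨by omega⟩
  have hne : (Finset.univ : Finset (Fin G)).Nonempty := Finset.univ_nonempty
  have hS : 0 < ∑ i, c i / a i := Finset.sum_pos (fun i _ => div_pos (hc i) (ha i)) hne
  have hy : 0 < ystar := hydef ▸ div_pos hS hP'
  have hsum : ∑ i, Pstar i = P' := by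
    have hterm : ∀ i, Pstar i = c i / a i / ystar - b i / a i := fun i => by
      rw [hPdef i, sub_div, div_right_comm]
    have hquot : (∑ i, c i / a i) / ystar = P' + ∑ i, b i / a i := by
      rw [hydef, div_div_cancel₀ hS.ne']
    simp only [hterm, Finset.sum_sub_distrib, ← Finset.sum_div, hquot, add_sub_cancel_right]
  have hrate : ∀ i, a i * Pstar i + b i = c i / ystar := fun i => by
    rw [hPdef i, mul_div_cancel₀ _ (ha i).ne', sub_add_cancel]
  refine ⟨hy, hsum, fun i => ⟨hrate i, div_pos (hc i) hy, ?_⟩, fun P hP hPsum => ?_⟩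
  · rw [hrate i, div_div_cancel₀ (hc i).ne']
  · obtain ⟨i, -, hi⟩ := Finset.exists_le_of_sum_le hne (hPsum.trans hsum.symm).le
    refine ⟨i, (le_div_comm₀ hy (hP i)).2 ?_⟩
    rw [← hrate i]
    gcongr
    exact (ha i).le
end

section
/- Let G ≥ 1 and for i ∈ {1,…,G} let α_i ∈ (0,1], λ_i > 0, B_i > 0, and let σ², D, Δf, Δf₀ be positive reals. Define Θ = √(Δf₀/(σ²·D·ln 2)) and Φ = 1/√(Σ_{j=1}^G B_j/(α_j·λ_j²)). For τ > 0, set y = √τ/(Θ·Φ) and P_i = (σ²·ln 2/(α_i·λ_i²))·(D·Θ·Φ·B_i/(Δf·√τ) + (1−α_i)/ln 2), and let γ_i = P_i·λ_i²/σ². Then for every i: α_i·γ_i + α_i − 1 = D·B_i·ln 2/(y·Δf) > 0, so that the linearized per-block latency D·B_i·ln 2/(Δf·(α_i·γ_i + α_i − 1)) equals y for all i; moreover the KKT multipliers ρ_i = (τ·σ²·D·ln 2/(Δf₀·y²))·B_i/(α_i·λ_i²) satisfy Σ_{i=1}^G ρ_i = 1. -/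
theorem stmt_11 (G : ℕ) (hG : 1 ≤ G) (α lam B : Fin G → ℝ)
    (hα : ∀ i, α i ∈ Set.Ioc (0 : ℝ) 1) (hlam : ∀ i, 0 < lam i) (hB : ∀ i, 0 < B i)
    (σ2 D Δf Δf0 : ℝ) (hσ2 : 0 < σ2) (hD : 0 < D) (hΔf : 0 < Δf) (hΔf0 : 0 < Δf0)
    (Θ Φ : ℝ)
    (hΘ : Θ = Real.sqrt (Δf0 / (σ2 * D * Real.log 2)))
    (hΦ : Φ = 1 / Real.sqrt (∑ j, B j / (α j * (lam j) ^ 2)))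
    (τ : ℝ) (hτ : 0 < τ)
    (y : ℝ) (hy : y = Real.sqrt τ / (Θ * Φ))
    (P : Fin G → ℝ)
    (hP : ∀ i, P i = (σ2 * Real.log 2 / (α i * (lam i) ^ 2)) *
      (D * Θ * Φ * B i / (Δf * Real.sqrt τ) + (1 - α i) / Real.log 2))
    (γ : Fin G → ℝ) (hγ : ∀ i, γ i = P i * (lam i) ^ 2 / σ2)
    (ρ : Fin G → ℝ)
    (hρ : ∀ i, ρ i = (τ * σ2 * D * Real.log 2 / (Δf0 * y ^ 2)) * B i / (α i * (lam i) ^ 2)) :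
    (∀ i, α i * γ i + α i - 1 = D * B i * Real.log 2 / (y * Δf) ∧
      0 < D * B i * Real.log 2 / (y * Δf) ∧
      D * B i * Real.log 2 / (Δf * (α i * γ i + α i - 1)) = y) ∧
    ∑ i, ρ i = 1 := by
  have : NeZero G := ⟨by omega⟩
  have hlog : 0 < Real.log 2 := Real.log_pos one_lt_two
  have hS : 0 < ∑ j, B j / (α j * lam j ^ 2) :=
    Finset.sum_pos
      (fun j _ => div_pos (hB j) (mul_pos (hα j).1 (pow_pos (hlam j) 2)))
      Finset.univ_nonempty
  set S := ∑ j, B j / (α j * lam j ^ 2) with hSdef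
  have hΘpos : 0 < Θ := by rw [hΘ]; positivity
  have hΦpos : 0 < Φ := by rw [hΦ]; positivity
  have hsτ : 0 < Real.sqrt τ := Real.sqrt_pos.2 hτ
  have hypos : 0 < y := by rw [hy]; positivity
  refine ⟨fun i => ?_, ?_⟩
  · have hαi := (hα i).1
    have hli := hlam i
    have hBi := hB i
    have hsnr : α i * γ i + α i - 1 = D * B i * Real.log 2 / (y * Δf) := by
      rw [hγ, hP, hy]
      field_simp
      ring
    refine ⟨hsnr, by positivity, ?_⟩
    rw [hsnr]
    field_simp
  · have hΘsq : Θ ^ 2 = Δf0 / (σ2 * D * Real.log 2) := by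
      rw [hΘ, Real.sq_sqrt (by positivity)]
    have hΦsq : Φ ^ 2 = 1 / S := by
      rw [hΦ, div_pow, one_pow, Real.sq_sqrt hS.le]
    have hysq : y ^ 2 = τ * σ2 * D * Real.log 2 * S / Δf0 := by
      rw [hy, div_pow, mul_pow, Real.sq_sqrt hτ.le, hΘsq, hΦsq]
      field_simp
    simp_rw [hρ, mul_div_assoc (_ / _), ← Finset.mul_sum]
    rw [← hSdef, hysq]
    field_simp
end

section
/- Let G ≥ 1 and for i ∈ {1,…,G} let α_i ∈ (0,1], λ_i > 0, B_i > 0, and let σ², D, Δf, Δf₀ be positive reals. Define Θ = √(Δf₀/(σ²·D·ln 2)) and Ξ = 1/√(Σ_{j=1}^G B_j/λ_j²). For τ > 0, set y = √τ/(Θ·Ξ) and P_i = (σ²·ln 2/λ_i²)·(D·Θ·Ξ·B_i/(Δf·√τ) + 2·(1−α_i)/ln 2), and let γ_i = P_i·λ_i²/σ². Then for every i: γ_i − 2 + 2·α_i = D·B_i·ln 2/(y·Δf) > 0, so that the linearized per-block latency D·B_i·ln 2/(Δf·(γ_i − 2 + 2·α_i)) equals y for all i; moreover the KKT multipliers ρ_i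 = (τ·σ²·D·ln 2/(Δf₀·y²))·B_i/λ_i² satisfy Σ_{i=1}^G ρ_i = 1. -/
theorem stmt_12 (G : ℕ) (hG : 1 ≤ G) (α lam B : Fin G → ℝ)
    (hα : ∀ i, α i ∈ Set.Ioc (0 : ℝ) 1) (hlam : ∀ i, 0 < lam i) (hB : ∀ i, 0 < B i)
    (σ2 D Δf Δf0 : ℝ) (hσ2 : 0 < σ2) (hD : 0 < D) (hΔf : 0 < Δf) (hΔf0 : 0 < Δf0)
    (Θ Ξ : ℝ)
    (hΘ : Θ = Real.sqrt (Δf0 / (σ2 * D * Real.log 2)))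
    (hΞ : Ξ = 1 / Real.sqrt (∑ j, B j / (lam j) ^ 2))
    (τ : ℝ) (hτ : 0 < τ)
    (y : ℝ) (hy : y = Real.sqrt τ / (Θ * Ξ))
    (P : Fin G → ℝ)
    (hP : ∀ i, P i = (σ2 * Real.log 2 / (lam i) ^ 2) *
      (D * Θ * Ξ * B i / (Δf * Real.sqrt τ) + 2 * (1 - α i) / Real.log 2))
    (γ : Fin G → ℝ) (hγ : ∀ i, γ i = P i * (lam i) ^ 2 / σ2)
    (ρ : Fin G → ℝ)
    (hρ : ∀ i, ρ i = (τ * σ2 * D * Real.log 2 / (Δf0 * y ^ 2)) * B i / (lam i) ^ 2) :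
    (∀ i, γ i - 2 + 2 * α i = D * B i * Real.log 2 / (y * Δf) ∧
      0 < D * B i * Real.log 2 / (y * Δf) ∧
      D * B i * Real.log 2 / (Δf * (γ i - 2 + 2 * α i)) = y) ∧
    ∑ i, ρ i = 1 := by
  have : Nonempty (Fin G) := ⟨⟨0, hG⟩⟩
  have hL : 0 < Real.log 2 := Real.log_pos one_lt_two
  have hS : 0 < ∑ j, B j / (lam j) ^ 2 :=
    Finset.sum_pos (fun j _ => div_pos (hB j) (pow_pos (hlam j) 2)) Finset.univ_nonempty
  have hq : 0 < Δf0 / (σ2 * D * Real.log 2) := by positivity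
  have hΘ0 : 0 < Θ := hΘ ▸ Real.sqrt_pos.2 hq
  have hΞ0 : 0 < Ξ := hΞ ▸ one_div_pos.2 (Real.sqrt_pos.2 hS)
  have hsτ : 0 < Real.sqrt τ := Real.sqrt_pos.2 hτ
  have hy0 : 0 < y := by rw [hy]; positivity
  have hy2 : y ^ 2 = τ * σ2 * D * Real.log 2 / Δf0 * ∑ j, B j / (lam j) ^ 2 := by
    rw [hy, div_pow, mul_pow, hΘ, hΞ, div_pow, Real.sq_sqrt hτ.le, Real.sq_sqrt hq.le,
      Real.sq_sqrt hS.le]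
    field_simp
  refine ⟨fun i => ?_, ?_⟩
  · have hBi := hB i
    have hli := hlam i
    have hgap : γ i - 2 + 2 * α i = D * B i * Real.log 2 / (y * Δf) := by
      rw [hγ, hP, hy]
      field_simp
      ring
    refine ⟨hgap, by positivity, ?_⟩
    rw [hgap]
    field_simp
  · simp_rw [hρ, mul_div_assoc _ (B _)]
    rw [← Finset.mul_sum, hy2]
    field_simp
end

section
/- Let G ≥ 1 and let D, Δf, σ² be positive reals, and for each i ∈ {1,…,G} let B_i > 0 and λ_i > 0. Then the set S = {(P, y) ∈ ℝ^G × ℝ : y > 0, P_i > 0 for all i, and D·B_i ≤ y·Δf·log₂(1 + P_i·λ_i²/σ²) for all i} is a convex subset of ℝ^G × ℝ. -/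
/-- The set `{(u, v) | 0 < u, c ≤ u * v}` with `0 ≤ c` is convex. -/
theorem convex_setOf_le_mul {c : ℝ} (hc : 0 ≤ c) :
    Convex ℝ {p : ℝ × ℝ | 0 < p.1 ∧ c ≤ p.1 * p.2} := by
  have heq : {p : ℝ × ℝ | 0 < p.1 ∧ c ≤ p.1 * p.2} =
      {p : ℝ × ℝ | p.1 ∈ Set.Ioi 0 ∧ c • p.1⁻¹ ≤ p.2} := by
    ext p
    refine and_congr_right fun hp => ?_
    rw [smul_eq_mul, ← div_eq_mul_inv, div_le_iff₀' hp]
  have hinv : ConvexOn ℝ (Set.Ioi 0) fun x : ℝ => x⁻¹ := by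
    simpa using convexOn_zpow (𝕜 := ℝ) (-1)
  rw [heq]
  exact (hinv.smul hc).convex_epigraph

/-- The logarithm to a base `b > 1` is concave on the positive reals. -/
theorem Real.concaveOn_logb_Ioi {b : ℝ} (hb : 1 < b) :
    ConcaveOn ℝ (Set.Ioi 0) (Real.logb b) := by
  have h := strictConcaveOn_log_Ioi.concaveOn.smul (inv_nonneg.2 (Real.log_pos hb).le)
  refine h.congr fun x _ => ?_
  simp [Real.logb, div_eq_inv_mul]

theorem stmt_14 (G : ℕ) (hG : 1 ≤ G) (D Δf σ2 : ℝ) (hD : 0 < D) (hΔf : 0 < Δf)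
    (hσ2 : 0 < σ2) (B lam : Fin G → ℝ) (hB : ∀ i, 0 < B i) (hlam : ∀ i, 0 < lam i) :
    Convex ℝ {p : (Fin G → ℝ) × ℝ | 0 < p.2 ∧ (∀ i, 0 < p.1 i) ∧
      ∀ i, D * B i ≤ p.2 * Δf * Real.logb 2 (1 + p.1 i * (lam i) ^ 2 / σ2)} := by
  rintro ⟨P, y⟩ ⟨hy, hP, hPy⟩ ⟨Q, z⟩ ⟨hz, hQ, hQz⟩ a b ha hb hab
  dsimp only at hy hP hPy hz hQ hQz
  have hpos : ∀ {s t : ℝ}, 0 < s → 0 < t → 0 < a * s + b * t := fun hs ht =>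
    convex_Ioi (0 : ℝ) hs ht ha hb hab
  refine ⟨hpos hy hz, fun i => hpos (hP i) (hQ i), fun i => ?_⟩
  have hgain : 0 < lam i ^ 2 / σ2 := div_pos (pow_pos (hlam i) 2) hσ2
  have harg : ∀ {s : ℝ}, 0 < s → 0 < 1 + s * lam i ^ 2 / σ2 := fun hs => by
    rw [mul_div_assoc]; positivity
  have hlog := (Real.concaveOn_logb_Ioi one_lt_two).2 (harg (hP i)) (harg (hQ i)) ha hb hab
  obtain ⟨hu, hmul⟩ := convex_setOf_le_mul (mul_pos hD (hB i)).le
    (x := (y * Δf, Real.logb 2 (1 + P i * lam i ^ 2 / σ2)))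
    (y := (z * Δf, Real.logb 2 (1 + Q i * lam i ^ 2 / σ2)))
    ⟨mul_pos hy hΔf, hPy i⟩ ⟨mul_pos hz hΔf, hQz i⟩ ha hb hab
  refine hmul.trans ((mul_le_mul_of_nonneg_left hlog hu.le).trans_eq ?_)
  simp only [Prod.fst_add, Prod.snd_add, Prod.smul_fst, Prod.smul_snd, Pi.add_apply,
    Pi.smul_apply, smul_eq_mul]
  congr 1
  · ring
  · congr 1
    linear_combination hab
end
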